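/- Let |q| < 1, |ρ| < 1, and let i, j, m, k ≥ 0 be integers with i + j ≠ m + k. Then ∫_{S(q)} ∫_{S(q)} Q_{i,j}(x,y|ρ,q) Q_{m,k}(x,y|ρ,q) f_{2D}(x,y|ρ,q) dx dy = 0. -/

import Mathlib

open Finset MeasureTheory

noncomputable section

/-- [n]_q = 1 + q + ... + q^{n-1} -/
def qNat (q : ℝ) (n : ℕ) : ℝ := ∑ j ∈ Finset.range n, q ^ j

/-- [n]_q! -/
def qFact (q : ℝ) : ℕ → ℝ
  | 0 => 1
  | n + 1 => qFact q n * qNat q (n + 1)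

/-- q-binomial coefficient -/
def qBinom (q : ℝ) (n k : ℕ) : ℝ :=
  if k ≤ n then qFact q n / (qFact q (n - k) * qFact q k) else 0

/-- q-Pochhammer symbol (a;q)_n -/
def qPoch (a q : ℝ) (n : ℕ) : ℝ := ∏ j ∈ Finset.range n, (1 - a * q ^ j)

/-- q-Pochhammer symbol (a;q)_∞ -/
def qPochInf (a q : ℝ) : ℝ := ∏' j : ℕ, (1 - a * q ^ j)

/-- continuous q-Hermite polynomials H_n(x|q) -/
def qHermite (q : ℝ) : ℕ → ℝ → ℝ
  | 0, _ => 1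
  | 1, x => x
  | n + 2, x => x * qHermite q (n + 1) x - qNat q (n + 1) * qHermite q n x

/-- big q-Hermite polynomials H_n(x|a,q) -/
def bigqHermite (q a : ℝ) : ℕ → ℝ → ℝ
  | 0, _ => 1
  | 1, x => x - a
  | n + 2, x => (x - a * q ^ (n + 1)) * bigqHermite q a (n + 1) x -
      qNat q (n + 1) * bigqHermite q a n x

/-- rescaled Al-Salam--Chihara polynomials P_n(x|y,ρ,q) -/
def ascP (q y ρ : ℝ) : ℕ → ℝ → ℝ
  | 0, _ => 1
  | 1, x => x - ρ * y
  | n + 2, x => (x - ρ * y * q ^ (n + 1)) * ascP q y ρ (n + 1) x -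
      qNat q (n + 1) * (1 - ρ ^ 2 * q ^ n) * ascP q y ρ n x

/-- generating function φ_H(x|t,q) of the q-Hermite polynomials -/
def phiH (q t x : ℝ) : ℝ := ∑' n : ℕ, t ^ n / qFact q n * qHermite q n x

/-- γ_{i,j}(x,y|ρ,q) -/
def gammaPM (q ρ : ℝ) (i j : ℕ) (x y : ℝ) : ℝ :=
  ∑' n : ℕ, ρ ^ n / qFact q n * qHermite q (n + i) x * qHermite q (n + j) y

/-- the polynomials Q_{i,j}(x,y|ρ,q) -/
def Qpoly (q ρ : ℝ) (i j : ℕ) (x y : ℝ) : ℝ :=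
  ∑ s ∈ Finset.range (j + 1),
    (-1 : ℝ) ^ s * q ^ (s * (s - 1) / 2) * qBinom q j s * ρ ^ s * qHermite q (j - s) y *
      ascP q y ρ (i + s) x / qPoch (ρ ^ 2) q (i + s)

/-- the interval S(q) = [-2/√(1-q), 2/√(1-q)] -/
def Sq (q : ℝ) : Set ℝ := Set.Icc (-(2 / Real.sqrt (1 - q))) (2 / Real.sqrt (1 - q))

/-- ω(x,y|ρ) -/
def omegaPM (x y ρ : ℝ) : ℝ :=
  (1 - ρ ^ 2) ^ 2 - 4 * ρ * (1 + ρ ^ 2) * x * y + 4 * ρ ^ 2 * (x ^ 2 + y ^ 2)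

/-- l(x|a) -/
def lPM (x a : ℝ) : ℝ := (1 + a) ^ 2 - 4 * a * x ^ 2

/-- the q-Normal density f_N(x|q) -/
def fN (q x : ℝ) : ℝ :=
  Real.sqrt ((1 - q) * (4 - (1 - q) * x ^ 2)) * qPochInf q q / (2 * Real.pi) *
    ∏' j : ℕ, lPM (x * Real.sqrt (1 - q) / 2) (q ^ (j + 1))

/-- the (q,ρ)-Conditional Normal density f_CN(x|y,ρ,q) -/
def fCN (q ρ x y : ℝ) : ℝ :=
  fN q x * qPochInf (ρ ^ 2) q /
    ∏' j : ℕ, omegaPM (x * Real.sqrt (1 - q) / 2) (y * Real.sqrt (1 - q) / 2) (ρ * q ^ j)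

/-- the (ρ,q)-bivariate Normal density f_{2D}(x,y|ρ,q) -/
def f2D (q ρ x y : ℝ) : ℝ := fCN q ρ x y * fN q y

open Filter Topology

section Chebyshev

open Polynomial.Chebyshev

theorem integral_chebyshevU_mul_sqrt (n : ℕ) (hn : n ≠ 0) :
    ∫ x in Set.Icc (-1 : ℝ) 1, (U ℝ n).eval x * √(1 - x ^ 2) = 0 := by
  have h1 : ∀ x ∈ Set.uIcc (-1 : ℝ) 1, (U ℝ n).eval x * √(1 - x ^ 2) =
      (1 / 2 * ((T ℝ n).eval x - (T ℝ (n + 2)).eval x)) * √(1 - x ^ 2)⁻¹ := by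
    intro x hx
    rw [Set.uIcc_of_le (by norm_num)] at hx
    have h0 : 0 ≤ 1 - x ^ 2 := by nlinarith [hx.1, hx.2]
    have hU := congrArg (Polynomial.eval x) (one_sub_X_sq_mul_U_eq_pol_in_T ℝ n)
    have hT := congrArg (Polynomial.eval x) (T_add_two ℝ n)
    simp only [Polynomial.eval_mul, Polynomial.eval_sub, Polynomial.eval_one,
      Polynomial.eval_pow, Polynomial.eval_X, Polynomial.eval_ofNat] at hU hT
    have h2 : 1 / 2 * ((T ℝ n).eval x - (T ℝ (n + 2)).eval x) = (1 - x ^ 2) * (U ℝ n).eval x := by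
      rw [hU]; linarith
    rw [h2, Real.sqrt_inv]
    rcases h0.eq_or_lt with h | h
    · simp [← h]
    · have := Real.sqrt_pos.2 h
      field_simp
      rw [Real.sq_sqrt h0]
  rw [integral_Icc_eq_integral_Ioc, ← intervalIntegral.integral_of_le (by norm_num),
    intervalIntegral.integral_congr h1, ← integral_measureT, integral_const_mul,
    integral_sub (integrable_measureT (by fun_prop)) (integrable_measureT (by fun_prop)),
    integral_eval_T_real_measureT_of_ne_zero (by exact_mod_cast hn),
    integral_eval_T_real_measureT_of_ne_zero (by omega)]
  simp

theorem two_mul_mul_eval_chebyshevU (m : ℤ) (x : ℝ) :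
    2 * x * (U ℝ m).eval x = (U ℝ (m + 1)).eval x + (U ℝ (m - 1)).eval x := by
  have h := congrArg (Polynomial.eval x) (U_sub_one ℝ m)
  simp only [Polynomial.eval_mul, Polynomial.eval_sub,
    Polynomial.eval_X, Polynomial.eval_ofNat] at h
  linarith

theorem eval_chebyshevU_neg_two_sub (m : ℤ) (x : ℝ) :
    (U ℝ (-2 - m)).eval x = -(U ℝ m).eval x := by
  rw [← Polynomial.eval_neg, ← U_neg_sub_two]
  congr 2
  ring

theorem lPM_mul_eval_chebyshevU (m : ℤ) (x a : ℝ) :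
    lPM x a * (U ℝ m).eval x = (1 + a ^ 2) * (U ℝ m).eval x -
      a * ((U ℝ (m + 2)).eval x + (U ℝ (m - 2)).eval x) := by
  have h0 := two_mul_mul_eval_chebyshevU m x
  have h1 := two_mul_mul_eval_chebyshevU (m + 1) x
  have h2 := two_mul_mul_eval_chebyshevU (m - 1) x
  ring_nf at h0 h1 h2 ⊢
  unfold lPM
  linear_combination (-a * 2 * x) * h0 - a * h1 - a * h2

/-- The weight `√(1 - x²)` multiplied by the first `N` factors of the product in `fN`. -/
def truncWeight (q : ℝ) (N : ℕ) (x : ℝ) : ℝ :=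
  √(1 - x ^ 2) * ∏ j ∈ Finset.range N, lPM x (q ^ (j + 1))

/-- The weight `√(1 - x²) ∏_{j ≥ 1} l(x | q ^ j)`. -/
def fullWeight (q x : ℝ) : ℝ := √(1 - x ^ 2) * ∏' j : ℕ, lPM x (q ^ (j + 1))

@[fun_prop]
theorem continuous_lPM (a : ℝ) : Continuous fun x => lPM x a := by
  unfold lPM; fun_prop

@[fun_prop]
theorem continuous_truncWeight (q : ℝ) (N : ℕ) : Continuous (truncWeight q N) := by
  unfold truncWeight; fun_prop

theorem integral_chebyshevU_mul_truncWeight_succ (q : ℝ) (N : ℕ) (m : ℤ) :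
    ∫ x in Set.Icc (-1 : ℝ) 1, (U ℝ m).eval x * truncWeight q (N + 1) x =
      (1 + (q ^ (N + 1)) ^ 2) * (∫ x in Set.Icc (-1 : ℝ) 1, (U ℝ m).eval x * truncWeight q N x) -
      q ^ (N + 1) * ((∫ x in Set.Icc (-1 : ℝ) 1, (U ℝ (m + 2)).eval x * truncWeight q N x) +
        ∫ x in Set.Icc (-1 : ℝ) 1, (U ℝ (m - 2)).eval x * truncWeight q N x) := by
  have hi : ∀ k : ℤ, IntegrableOn (fun x => (U ℝ k).eval x * truncWeight q N x)
      (Set.Icc (-1 : ℝ) 1) := fun k =>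
    (Continuous.mul (by fun_prop) (by fun_prop)).continuousOn.integrableOn_Icc
  have hadd : IntegrableOn (fun x => (U ℝ (m + 2)).eval x * truncWeight q N x +
      (U ℝ (m - 2)).eval x * truncWeight q N x) (Set.Icc (-1 : ℝ) 1) := (hi _).add (hi _)
  rw [← integral_add (hi _) (hi _), ← integral_const_mul, ← integral_const_mul,
    ← integral_sub ((hi _).const_mul _) (hadd.const_mul _)]
  congr 1
  ext x
  have := lPM_mul_eval_chebyshevU m x (q ^ (N + 1))
  simp only [truncWeight, Finset.prod_range_succ]
  simp only [← add_mul, ← mul_assoc]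
  linear_combination √(1 - x ^ 2) * (∏ j ∈ Finset.range N, lPM x (q ^ (j + 1))) * this

theorem integral_odd_chebyshevU_mul_truncWeight (q : ℝ) (N k : ℕ) :
    ∫ x in Set.Icc (-1 : ℝ) 1, (U ℝ (2 * k + 1)).eval x * truncWeight q N x = 0 := by
  induction N generalizing k with
  | zero => simpa [truncWeight] using integral_chebyshevU_mul_sqrt (2 * k + 1) (by omega)
  | succ N ih =>
    rw [integral_chebyshevU_mul_truncWeight_succ, ih]
    have h1 := ih (k + 1)
    rw [show (2 * ((k + 1 : ℕ) : ℤ) + 1) = 2 * k + 1 + 2 by push_cast; ring] at h1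
    rw [h1]
    rcases k with _ | k
    · simp
    · rw [show (2 * ((k + 1 : ℕ) : ℤ) + 1 - 2) = 2 * k + 1 by push_cast; ring, ih]
      simp

theorem integral_even_chebyshevU_mul_truncWeight {q : ℝ} (hq : |q| < 1) (N k : ℕ) :
    (1 - q ^ (N + k + 2)) *
      (∫ x in Set.Icc (-1 : ℝ) 1, (U ℝ (2 * k + 2)).eval x * truncWeight q N x) =
    -(q ^ (k + 1) - q ^ (N + 1)) *
      ∫ x in Set.Icc (-1 : ℝ) 1, (U ℝ (2 * k)).eval x * truncWeight q N x := by
  induction N generalizing k with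
  | zero =>
    have h (k : ℕ) : ∫ x in Set.Icc (-1 : ℝ) 1,
        (U ℝ (2 * k + 2)).eval x * truncWeight q 0 x = 0 := by
      simpa [truncWeight] using integral_chebyshevU_mul_sqrt (2 * k + 2) (by omega)
    rw [h]
    rcases k with _ | k
    · simp
    · have := h k
      push_cast
      rw [mul_add, mul_one, this]
      simp
  | succ N ih =>
    rw [integral_chebyshevU_mul_truncWeight_succ, integral_chebyshevU_mul_truncWeight_succ]
    set I : ℤ → ℝ := fun m => ∫ x in Set.Icc (-1 : ℝ) 1, (U ℝ m).eval x * truncWeight q N x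
    have hI : ∀ m, ∫ x in Set.Icc (-1 : ℝ) 1, (U ℝ m).eval x * truncWeight q N x = I m :=
      fun _ => rfl
    simp only [hI] at ih ⊢
    have hne : ∀ n : ℕ, 1 - q ^ (n + 1) ≠ 0 := fun n => by
      have h1 : |q ^ (n + 1)| < 1 := by
        rw [abs_pow]; exact pow_lt_one₀ (abs_nonneg q) hq (by omega)
      have := (abs_lt.1 h1).2
      linarith
    have e1 := ih k
    have e2 := ih (k + 1)
    have e0 : (1 - q ^ (N + k + 1)) * I (2 * k) = -(q ^ k - q ^ (N + 1)) * I (2 * k - 2) := by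
      rcases k with _ | k
      · have : I (-2) = - I 0 := by
          simp only [I]
          rw [← integral_neg]
          simp
        simp only [CharP.cast_eq_zero, mul_zero, zero_sub, this]
        ring
      · have := ih k
        rw [show (2 * ((k + 1 : ℕ) : ℤ) - 2) = 2 * k by push_cast; ring,
          show (2 * ((k + 1 : ℕ) : ℤ)) = 2 * k + 2 by push_cast; ring]
        convert this using 3
        ring
    rw [show (2 * ((k + 1 : ℕ) : ℤ) + 2) = 2 * k + 2 + 2 by push_cast; ring,
      show (2 * ((k + 1 : ℕ) : ℤ)) = 2 * k + 2 by push_cast; ring] at e2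
    rw [show (2 * (k : ℤ) + 2 - 2) = 2 * k by ring]
    generalize I (2 * k + 2 + 2) = A at *
    generalize I (2 * k + 2) = B at *
    generalize I (2 * k - 2) = D at *
    generalize I (2 * k) = C at *
    have n0 := hne (N + k)
    have n1 := hne (N + k + 1)
    have n2 := hne (N + k + 2)
    rw [show N + (k + 1) + 2 = N + k + 2 + 1 by ring] at e2
    rw [show N + k + 2 = N + k + 1 + 1 by ring] at e1
    have hC : C = -(q ^ k - q ^ (N + 1)) * D / (1 - q ^ (N + k + 1)) := by
      rw [eq_div_iff n0]; linarith
    have hB : B = -(q ^ (k + 1) - q ^ (N + 1)) * C / (1 - q ^ (N + k + 1 + 1)) := by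
      rw [eq_div_iff n1]; linarith
    have hA : A = -(q ^ (k + 1 + 1) - q ^ (N + 1)) * B / (1 - q ^ (N + k + 2 + 1)) := by
      rw [eq_div_iff n2]; linarith
    subst hA hB hC
    field_simp
    ring

theorem summable_abs_pow_succ {q : ℝ} (hq : |q| < 1) : Summable fun j : ℕ => |q| ^ (j + 1) :=
  (summable_nat_add_iff 1).2 (summable_geometric_of_lt_one (abs_nonneg q) hq)

theorem tendsto_prod_lPM {q : ℝ} (hq : |q| < 1) (x : ℝ) :
    Tendsto (fun N => ∏ j ∈ Finset.range N, lPM x (q ^ (j + 1))) atTop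
      (𝓝 (∏' j : ℕ, lPM x (q ^ (j + 1)))) := by
  apply Multipliable.tendsto_prod_tprod_nat
  have h : ∀ j : ℕ, lPM x (q ^ (j + 1)) =
      1 + q ^ (j + 1) * (2 + q ^ (j + 1) - 4 * x ^ 2) := fun j => by
    unfold lPM; ring
  simp only [h]
  apply multipliable_one_add_of_summable
  refine Summable.of_nonneg_of_le (fun _ => norm_nonneg _) (fun j => ?_)
    ((summable_abs_pow_succ hq).mul_right (3 + 4 * x ^ 2))
  rw [norm_mul, norm_pow, Real.norm_eq_abs, Real.norm_eq_abs]
  gcongr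
  have h1 : |q ^ (j + 1)| ≤ 1 := by
    rw [abs_pow]; exact pow_le_one₀ (abs_nonneg q) hq.le
  rw [abs_le] at h1 ⊢
  constructor <;> nlinarith [sq_nonneg x]

theorem tendsto_truncWeight {q : ℝ} (hq : |q| < 1) (x : ℝ) :
    Tendsto (fun N => truncWeight q N x) atTop (𝓝 (fullWeight q x)) :=
  (tendsto_prod_lPM hq x).const_mul _

theorem exists_abs_truncWeight_le {q : ℝ} (hq : |q| < 1) :
    ∃ C, ∀ N, ∀ x ∈ Set.Icc (-1 : ℝ) 1, |truncWeight q N x| ≤ C := by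
  refine ⟨Real.exp (∑' j : ℕ, 3 * |q| ^ (j + 1)), fun N x hx => ?_⟩
  have hx2 : x ^ 2 ≤ 1 := by nlinarith [hx.1, hx.2]
  rw [truncWeight, abs_mul, Finset.abs_prod]
  have h1 : |√(1 - x ^ 2)| ≤ 1 := by
    rw [abs_of_nonneg (Real.sqrt_nonneg _)]
    exact Real.sqrt_le_one.2 (by nlinarith [sq_nonneg x])
  have h2 : ∏ j ∈ Finset.range N, |lPM x (q ^ (j + 1))| ≤
      Real.exp (∑' j : ℕ, 3 * |q| ^ (j + 1)) := by
    calc _ ≤ ∏ j ∈ Finset.range N, Real.exp (3 * |q| ^ (j + 1)) := by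
          refine Finset.prod_le_prod (fun _ _ => abs_nonneg _) fun j _ => ?_
          refine le_trans ?_ (Real.add_one_le_exp _)
          rw [show lPM x (q ^ (j + 1)) = q ^ (j + 1) * (2 + q ^ (j + 1) - 4 * x ^ 2) + 1 by
            unfold lPM; ring]
          refine (abs_add_le _ _).trans ?_
          rw [abs_one, abs_mul, abs_pow, mul_comm]
          gcongr
          have h1 : |q ^ (j + 1)| ≤ 1 := by
            rw [abs_pow]; exact pow_le_one₀ (abs_nonneg q) hq.le
          rw [abs_le] at h1 ⊢
          constructor <;> nlinarith [sq_nonneg x]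
      _ = Real.exp (∑ j ∈ Finset.range N, 3 * |q| ^ (j + 1)) := (Real.exp_sum _ _).symm
      _ ≤ _ := by
          apply Real.exp_le_exp.2
          exact ((summable_abs_pow_succ hq).mul_left 3).sum_le_tsum _ (fun _ _ => by positivity)
  calc _ ≤ 1 * _ := mul_le_mul h1 h2 (Finset.prod_nonneg fun _ _ => abs_nonneg _) zero_le_one
    _ = _ := one_mul _

theorem measurable_fullWeight {q : ℝ} (hq : |q| < 1) : Measurable (fullWeight q) :=
  measurable_of_tendsto_metrizable (fun N => (continuous_truncWeight q N).measurable)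
    (tendsto_pi_nhds.2 (tendsto_truncWeight hq))

theorem exists_abs_fullWeight_le {q : ℝ} (hq : |q| < 1) :
    ∃ C, ∀ x ∈ Set.Icc (-1 : ℝ) 1, |fullWeight q x| ≤ C := by
  obtain ⟨C, hC⟩ := exists_abs_truncWeight_le hq
  exact ⟨C, fun x hx => le_of_tendsto (tendsto_truncWeight hq x).abs
    (Eventually.of_forall fun N => hC N x hx)⟩

theorem tendsto_integral_mul_truncWeight {q : ℝ} (hq : |q| < 1) {g : ℝ → ℝ}
    (hg : Continuous g) :
    Tendsto (fun N => ∫ x in Set.Icc (-1 : ℝ) 1, g x * truncWeight q N x) atTop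
      (𝓝 (∫ x in Set.Icc (-1 : ℝ) 1, g x * fullWeight q x)) := by
  obtain ⟨C, hC⟩ := exists_abs_truncWeight_le hq
  refine tendsto_integral_of_dominated_convergence (fun x => |g x| * C)
    (fun N => by fun_prop) (by
      have : Continuous fun x => |g x| * C := by fun_prop
      exact this.continuousOn.integrableOn_Icc) (fun N => ?_) ?_
  · filter_upwards [ae_restrict_mem measurableSet_Icc] with x hx
    rw [norm_mul, Real.norm_eq_abs, Real.norm_eq_abs]
    gcongr
    exact hC N x hx
  · exact Eventually.of_forall fun x => (tendsto_truncWeight hq x).const_mul _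

theorem integral_odd_chebyshevU_mul_fullWeight {q : ℝ} (hq : |q| < 1) (k : ℕ) :
    ∫ x in Set.Icc (-1 : ℝ) 1, (U ℝ (2 * k + 1)).eval x * fullWeight q x = 0 := by
  refine tendsto_nhds_unique (tendsto_integral_mul_truncWeight hq (by fun_prop)) ?_
  simp only [integral_odd_chebyshevU_mul_truncWeight]
  exact tendsto_const_nhds

theorem integral_even_chebyshevU_mul_fullWeight {q : ℝ} (hq : |q| < 1) (k : ℕ) :
    ∫ x in Set.Icc (-1 : ℝ) 1, (U ℝ (2 * k + 2)).eval x * fullWeight q x =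
    -q ^ (k + 1) * ∫ x in Set.Icc (-1 : ℝ) 1, (U ℝ (2 * k)).eval x * fullWeight q x := by
  have h1 : Tendsto (fun N : ℕ => 1 - q ^ (N + k + 2)) atTop (𝓝 (1 - 0)) :=
    ((tendsto_add_atTop_iff_nat (k + 2)).2
      (tendsto_pow_atTop_nhds_zero_of_abs_lt_one hq)).const_sub 1
  have h2 : Tendsto (fun N : ℕ => -(q ^ (k + 1) - q ^ (N + 1))) atTop
      (𝓝 (-(q ^ (k + 1) - 0))) :=
    ((((tendsto_add_atTop_iff_nat 1).2
      (tendsto_pow_atTop_nhds_zero_of_abs_lt_one hq))).const_sub _).neg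
  have h3 := h1.mul (tendsto_integral_mul_truncWeight hq
    (g := fun x => (U ℝ (2 * k + 2)).eval x) (by fun_prop))
  simp only [integral_even_chebyshevU_mul_truncWeight hq] at h3
  have h4 := tendsto_nhds_unique h3 (h2.mul (tendsto_integral_mul_truncWeight hq
    (g := fun x => (U ℝ (2 * k)).eval x) (by fun_prop)))
  simpa using h4

end Chebyshev

/-- Mixed moments of `q`-Hermite and Chebyshev polynomials vanish below the diagonal. -/
theorem eq_zero_of_qHermite_chebyshev_recurrence {q : ℝ} {d : ℕ → ℤ → ℝ}
    (h_neg : ∀ n m, d n (-2 - m) = -d n m)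
    (h_one : ∀ m, d 1 m = d 0 (m + 1) + d 0 (m - 1))
    (h_rec : ∀ n m, d (n + 2) m =
      d (n + 1) (m + 1) + d (n + 1) (m - 1) - (1 - q ^ (n + 1)) * d n m)
    (h_odd : ∀ k : ℕ, d 0 (2 * k + 1) = 0)
    (h_even : ∀ k : ℕ, d 0 (2 * k + 2) = -q ^ (k + 1) * d 0 (2 * k)) (n : ℕ) :
    ∀ m : ℤ, -n - 2 < m → m < n → d n m = 0 := by
  have h0 : ∀ r : ℤ, d 0 (2 * r + 1) = 0 := by
    intro r
    rcases le_or_gt 0 r with hr | hr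
    · lift r to ℕ using hr
      exact h_odd r
    · have h := h_neg 0 (2 * r + 1)
      rcases eq_or_ne r (-1) with rfl | hr1
      · norm_num at h ⊢
        linarith
      · obtain ⟨k, rfl⟩ : ∃ k : ℕ, r = -k - 2 := ⟨(-r - 2).toNat, by omega⟩
        rw [show -2 - (2 * (-(k : ℤ) - 2) + 1) = 2 * k + 1 by ring, h_odd] at h
        linarith
  have h_par : ∀ n : ℕ, ∀ r : ℤ, d n (n + 2 * r + 1) = 0 := by
    intro n
    induction n using Nat.twoStepInduction with
    | zero => simpa using h0
    | one =>
      intro r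
      have h1 := h0 (r + 1)
      have h2 := h0 r
      rw [h_one]
      push_cast
      ring_nf at h1 h2 ⊢
      rw [h1, h2, add_zero]
    | more n ih ih1 =>
      intro r
      have h1 := ih1 (r + 1)
      have h2 := ih1 r
      have h3 := ih (r + 1)
      rw [h_rec]
      push_cast at *
      ring_nf at h1 h2 h3 ⊢
      rw [h1, h2, h3]
      ring
  have h_diag : ∀ n : ℕ, (∀ r : ℕ, d n (n + 2 * r) =
      (∏ i ∈ Finset.range n, (1 - q ^ (r + 1 + i))) * d 0 (2 * r)) ∧
      ∀ m : ℤ, -n - 2 < m → m < n → d n m = 0 := by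
    have h_neg_one : ∀ n, d n (-1) = 0 := fun n => by
      have h := h_neg n (-1)
      norm_num at h
      linarith
    intro n
    induction n using Nat.twoStepInduction with
    | zero =>
      refine ⟨fun r => by simp, fun m h1 h2 => ?_⟩
      obtain rfl : m = -1 := by push_cast at *; omega
      exact h_neg_one 0
    | one =>
      refine ⟨fun r => ?_, fun m h1 h2 => ?_⟩
      · have h := h_even r
        rw [h_one, Nat.cast_one, show (1 + 2 * (r : ℤ) + 1) = 2 * r + 2 by ring, h,
          show (1 + 2 * (r : ℤ) - 1) = 2 * r by ring]
        simp
        ring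
      · obtain rfl | rfl | rfl : m = -2 ∨ m = -1 ∨ m = 0 := by push_cast at *; omega
        · rw [show (-2 : ℤ) = -2 - 0 by ring, h_neg]
          simpa using h_par 1 (-1)
        · exact h_neg_one 1
        · simpa using h_par 1 (-1)
    | more n ih ih1 =>
      have e1 : ∀ r : ℕ, d (n + 1) (n + 1 + 2 * r) =
          (∏ i ∈ Finset.range (n + 1), (1 - q ^ (r + 1 + i))) * d 0 (2 * r) := by
        exact_mod_cast ih1.1
      refine ⟨fun r => ?_, fun m h1 h2 => ?_⟩
      · rw [h_rec]
        have a1 := e1 (r + 1)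
        have a2 := e1 r
        have a3 := ih.1 (r + 1)
        push_cast at a1 a2 a3 ⊢
        rw [show (n + 2 + 2 * r + 1 : ℤ) = n + 1 + 2 * (r + 1) by ring, a1,
          show (n + 2 + 2 * r - 1 : ℤ) = n + 1 + 2 * r by ring, a2,
          show (n + 2 + 2 * r : ℤ) = n + 2 * (r + 1) by ring, a3, mul_add (2 : ℤ), mul_one, h_even]
        have p : ∏ i ∈ Finset.range (n + 1), (1 - q ^ (r + 1 + i)) =
            (1 - q ^ (r + 1)) * ∏ i ∈ Finset.range n, (1 - q ^ (r + 1 + 1 + i)) := by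
          rw [Finset.prod_range_succ', mul_comm, add_zero]
          congr 1
          exact Finset.prod_congr rfl fun i _ => by rw [add_right_comm (r + 1), add_assoc (r + 1)]
        rw [Finset.prod_range_succ _ (n + 1), p, Finset.prod_range_succ _ n]
        ring
      · push_cast at *
        have hz : ∀ m : ℤ, -(n : ℤ) - 3 < m → m < n + 1 → d (n + 1) m = 0 :=
          fun m a b => ih1.2 m (by omega) (by omega)
        have hdd : d (n + 1) (n + 1) = (1 - q ^ (n + 1)) * d n n := by
          have a1 := e1 0
          have a2 := ih.1 0
          simp only [CharP.cast_eq_zero, mul_zero, add_zero, zero_add] at a1 a2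
          rw [a1, a2, Finset.prod_range_succ, add_comm 1 n]
          ring
        have hnn : ∀ m : ℤ, 0 ≤ m → m < n + 2 → d (n + 2) m = 0 := fun m h1 h2 => by
          rw [h_rec]
          obtain rfl | rfl | h : m = n + 1 ∨ m = n ∨ m < n := by omega
          · have a1 := h_par (n + 1) 0
            have a2 := h_par n 0
            push_cast at a1 a2
            simp only [add_zero] at a1 a2
            rw [a1, a2, hz _ (by omega) (by omega)]
            simp
          · rw [hdd, hz _ (by omega) (by omega)]
            ring
          · rw [hz _ (by omega) (by omega), hz _ (by omega) (by omega), ih.2 m (by omega) h]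
            simp
        obtain h | rfl | h : 0 ≤ m ∨ m = -1 ∨ 0 ≤ -2 - m := by omega
        · exact hnn m h h2
        · exact h_neg_one _
        · have := h_neg (n + 2) m
          rw [hnn _ h (by omega)] at this
          linarith
  exact (h_diag n).2

section Orthogonality

theorem sqrt_one_sub_pos {q : ℝ} (hq : |q| < 1) : 0 < √(1 - q) :=
  Real.sqrt_pos.2 (by linarith [(abs_lt.1 hq).2])

theorem sq_sqrt_one_sub {q : ℝ} (hq : |q| < 1) : √(1 - q) ^ 2 = 1 - q :=
  Real.sq_sqrt (by linarith [(abs_lt.1 hq).2])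

theorem qNat_mul_one_sub (q : ℝ) (n : ℕ) : qNat q n * (1 - q) = 1 - q ^ n := by
  rw [qNat, mul_comm, mul_neg_geom_sum]

@[fun_prop]
theorem continuous_qHermite (q : ℝ) (n : ℕ) : Continuous (qHermite q n) := by
  induction n using Nat.twoStepInduction with
  | zero => exact continuous_const
  | one => exact continuous_id
  | more n h0 h1 =>
    change Continuous fun x => x * qHermite q (n + 1) x - qNat q (n + 1) * qHermite q n x
    fun_prop

theorem mem_Sq_iff {q : ℝ} (hq : |q| < 1) (x : ℝ) :
    x ∈ Sq q ↔ x * √(1 - q) / 2 ∈ Set.Icc (-1 : ℝ) 1 := by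
  have hs := sqrt_one_sub_pos hq
  rw [Sq, Set.mem_Icc, Set.mem_Icc, le_div_iff₀ hs, ← neg_div, div_le_iff₀ hs]
  constructor <;> rintro ⟨h1, h2⟩ <;> constructor <;> linarith

theorem measurableSet_Sq (q : ℝ) : MeasurableSet (Sq q) := measurableSet_Icc

theorem fN_eq_mul_fullWeight {q : ℝ} (hq : |q| < 1) (x : ℝ) :
    fN q x = 2 * √(1 - q) * qPochInf q q / (2 * Real.pi) *
      fullWeight q (x * √(1 - q) / 2) := by
  have hs := sqrt_one_sub_pos hq
  have h : √((1 - q) * (4 - (1 - q) * x ^ 2)) =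
      2 * √(1 - q) * √(1 - (x * √(1 - q) / 2) ^ 2) := by
    rw [show (1 - q) * (4 - (1 - q) * x ^ 2) =
      (2 * √(1 - q)) ^ 2 * (1 - (x * √(1 - q) / 2) ^ 2) by
        have := sq_sqrt_one_sub hq
        generalize √(1 - q) = s at *
        rw [← this]; ring,
      Real.sqrt_mul (sq_nonneg _), Real.sqrt_sq (by positivity)]
  rw [fN, fullWeight, h]
  ring

theorem setIntegral_Sq_comp {q : ℝ} (hq : |q| < 1) (f : ℝ → ℝ) :
    ∫ x in Sq q, f (x * √(1 - q) / 2) = 2 / √(1 - q) * ∫ x in Set.Icc (-1 : ℝ) 1, f x := by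
  have hs := sqrt_one_sub_pos hq
  rw [Sq, integral_Icc_eq_integral_Ioc, integral_Icc_eq_integral_Ioc,
    ← intervalIntegral.integral_of_le (by norm_num : (-1 : ℝ) ≤ 1),
    ← intervalIntegral.integral_of_le (neg_le_self (by positivity))]
  simp only [mul_div_assoc]
  rw [intervalIntegral.integral_comp_mul_right _ (by positivity), smul_eq_mul, inv_div]
  congr 2
  · field_simp
  · field_simp

theorem measurable_fN {q : ℝ} (hq : |q| < 1) : Measurable (fN q) := by
  rw [funext (fN_eq_mul_fullWeight hq)]
  exact ((measurable_fullWeight hq).comp (by fun_prop)).const_mul _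

theorem exists_abs_fN_le {q : ℝ} (hq : |q| < 1) : ∃ C, ∀ x ∈ Sq q, |fN q x| ≤ C := by
  obtain ⟨C, hC⟩ := exists_abs_fullWeight_le hq
  refine ⟨|2 * √(1 - q) * qPochInf q q / (2 * Real.pi)| * C, fun x hx => ?_⟩
  rw [fN_eq_mul_fullWeight hq, abs_mul]
  gcongr
  exact hC _ ((mem_Sq_iff hq x).1 hx)

theorem integrableOn_mul_fN_of_continuousOn {q : ℝ} (hq : |q| < 1) {g : ℝ → ℝ}
    (hg : ContinuousOn g (Sq q)) : IntegrableOn (fun x => g x * fN q x) (Sq q) := by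
  obtain ⟨C, hC⟩ := exists_abs_fN_le hq
  refine Integrable.mul_bdd (c := C) hg.integrableOn_Icc
    (measurable_fN hq).aestronglyMeasurable ?_
  filter_upwards [ae_restrict_mem measurableSet_Icc] with x hx using hC x hx

theorem integrableOn_mul_fN {q : ℝ} (hq : |q| < 1) {g : ℝ → ℝ} (hg : Continuous g) :
    IntegrableOn (fun x => g x * fN q x) (Sq q) :=
  integrableOn_mul_fN_of_continuousOn hq hg.continuousOn

open Polynomial.Chebyshev

theorem integral_chebyshevU_mul_qHermite_mul_fN {q : ℝ} (hq : |q| < 1) (n : ℕ) (m : ℤ)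
    (h1 : -n - 2 < m) (h2 : m < n) :
    ∫ x in Sq q, (U ℝ m).eval (x * √(1 - q) / 2) * qHermite q n x * fN q x = 0 := by
  have hs := sqrt_one_sub_pos hq
  have hi (n : ℕ) (m : ℤ) : IntegrableOn (fun x =>
      (U ℝ m).eval (x * √(1 - q) / 2) * qHermite q n x * fN q x) (Sq q) :=
    integrableOn_mul_fN hq (by fun_prop)
  have key := eq_zero_of_qHermite_chebyshev_recurrence (q := q) (d := fun n m => √(1 - q) ^ n *
    ∫ x in Sq q, (U ℝ m).eval (x * √(1 - q) / 2) * qHermite q n x * fN q x) ?_ ?_ ?_ ?_ ?_ n m h1 h2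
  · exact (mul_eq_zero.1 key).resolve_left (by positivity)
  · intro n m
    rw [← mul_neg, ← integral_neg]
    simp only [eval_chebyshevU_neg_two_sub, neg_mul]
  · intro m
    simp only [pow_one, pow_zero, one_mul]
    rw [← integral_const_mul, ← integral_add (hi _ _) (hi _ _)]
    congr 1
    ext x
    have := two_mul_mul_eval_chebyshevU m (x * √(1 - q) / 2)
    simp only [qHermite]
    linear_combination fN q x * this
  · intro n m
    have hadd : IntegrableOn (fun x => (U ℝ (m + 1)).eval (x * √(1 - q) / 2) *
        qHermite q (n + 1) x * fN q x + (U ℝ (m - 1)).eval (x * √(1 - q) / 2) *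
        qHermite q (n + 1) x * fN q x) (Sq q) := (hi _ _).add (hi _ _)
    rw [← mul_add, ← mul_assoc, ← integral_add (hi _ _) (hi _ _), ← integral_const_mul,
      ← integral_const_mul, ← integral_const_mul,
      ← integral_sub (hadd.const_mul _) ((hi _ _).const_mul _)]
    congr 1
    ext x
    have h1 := two_mul_mul_eval_chebyshevU m (x * √(1 - q) / 2)
    have h2 := qNat_mul_one_sub q (n + 1)
    have h3 := sq_sqrt_one_sub hq
    have h4 : qHermite q (n + 2) x =
      x * qHermite q (n + 1) x - qNat q (n + 1) * qHermite q n x := rfl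
    rw [h4, ← h2]
    linear_combination √(1 - q) ^ (n + 1) * qHermite q (n + 1) x * fN q x * h1 -
      √(1 - q) ^ n * (U ℝ m).eval (x * √(1 - q) / 2) * qNat q (n + 1) * qHermite q n x *
        fN q x * h3
  · intro k
    have := integral_odd_chebyshevU_mul_fullWeight hq k
    simp only [fN_eq_mul_fullWeight hq, qHermite, pow_zero, one_mul, mul_one]
    simp only [mul_left_comm (Polynomial.eval _ _)]
    rw [integral_const_mul,
      setIntegral_Sq_comp hq (fun x => (U ℝ (2 * k + 1)).eval x * fullWeight q x), this]
    simp
  · intro k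
    have := integral_even_chebyshevU_mul_fullWeight hq k
    simp only [fN_eq_mul_fullWeight hq, qHermite, pow_zero, one_mul, mul_one]
    simp only [mul_left_comm (Polynomial.eval _ _)]
    rw [integral_const_mul, integral_const_mul,
      setIntegral_Sq_comp hq (fun x => (U ℝ (2 * k + 2)).eval x * fullWeight q x),
      setIntegral_Sq_comp hq (fun x => (U ℝ (2 * k)).eval x * fullWeight q x), this]
    ring

theorem integral_pow_mul_qHermite_mul_fN {q : ℝ} (hq : |q| < 1) {n a : ℕ} (h : a < n) :
    ∫ x in Sq q, x ^ a * qHermite q n x * fN q x = 0 := by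
  have hs := sqrt_one_sub_pos hq
  have key : ∀ a : ℕ, ∀ m : ℤ, -n - 2 + a < m → m + a < n →
      ∫ x in Sq q, x ^ a * (U ℝ m).eval (x * √(1 - q) / 2) * qHermite q n x * fN q x = 0 := by
    intro a
    induction a with
    | zero =>
      intro m h1 h2
      simpa using integral_chebyshevU_mul_qHermite_mul_fN hq n m (by simpa using h1)
        (by simpa using h2)
    | succ a ih =>
      intro m h1 h2
      push_cast at h1 h2
      have e (x : ℝ) : x ^ (a + 1) * (U ℝ m).eval (x * √(1 - q) / 2) * qHermite q n x * fN q x =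
          1 / √(1 - q) *
          (x ^ a * (U ℝ (m + 1)).eval (x * √(1 - q) / 2) * qHermite q n x * fN q x +
          x ^ a * (U ℝ (m - 1)).eval (x * √(1 - q) / 2) * qHermite q n x * fN q x) := by
        have h1 := two_mul_mul_eval_chebyshevU m (x * √(1 - q) / 2)
        field_simp
        linear_combination x ^ a * qHermite q n x * fN q x * h1
      simp only [e]
      rw [integral_const_mul, integral_add (integrableOn_mul_fN hq (by fun_prop))
        (integrableOn_mul_fN hq (by fun_prop)), ih _ (by omega) (by omega),
        ih _ (by omega) (by omega)]
      simp
  simpa using key a 0 (by omega) (by omega)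

end Orthogonality

section Growth

theorem exists_abs_qHermite_le {q : ℝ} (hq : |q| < 1) :
    ∃ C, 0 ≤ C ∧ ∀ n : ℕ, ∀ x ∈ Sq q, √(1 - q) ^ n * |qHermite q n x| ≤ C * (n + 1) := by
  have hs := sqrt_one_sub_pos hq
  have hsum : Summable fun k : ℕ => ((k : ℝ) + 1) * |q| ^ k := by
    have h1 := summable_pow_mul_geometric_of_norm_lt_one 1 (r := |q|) (by simpa using hq)
    have h2 := summable_geometric_of_lt_one (abs_nonneg q) hq
    simpa [add_mul] using h1.add h2
  set E : ℕ → ℝ := fun n => Real.exp (∑ k ∈ Finset.range n, ((k : ℝ) + 1) * |q| ^ k)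
  have hE (n : ℕ) : E n * (1 + (n + 1) * |q| ^ n) ≤ E (n + 1) := by
    simp only [E, Finset.sum_range_succ, Real.exp_add]
    gcongr
    rw [add_comm]
    exact Real.add_one_le_exp _
  have hEpos (n : ℕ) : 0 < E n := Real.exp_pos _
  refine ⟨Real.exp (∑' k : ℕ, ((k : ℝ) + 1) * |q| ^ k), (Real.exp_pos _).le, fun n x hx => ?_⟩
  have hX := (mem_Sq_iff hq x).1 hx
  set X := x * √(1 - q) / 2 with hXdef
  set θ := Real.arccos X
  have hcos : Real.cos θ = X := Real.cos_arccos hX.1 hX.2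
  set z : ℂ := Complex.exp (θ * Complex.I)
  set w : ℂ := Complex.exp (-θ * Complex.I)
  have hz : ‖z‖ = 1 := Complex.norm_exp_ofReal_mul_I θ
  have hw : ‖w‖ = 1 := by
    have := Complex.norm_exp_ofReal_mul_I (-θ)
    simpa [w] using this
  have hzw : z * w = 1 := by
    simp only [z, w, ← Complex.exp_add]
    simp
  have hzw2 : z + w = 2 * X := by
    rw [← hcos, Complex.ofReal_cos, Complex.two_cos]
  set g : ℕ → ℂ := fun n => ((√(1 - q) ^ n * qHermite q n x : ℝ) : ℂ)
  have hg0 : g 0 = 1 := by simp [g, qHermite]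
  have hg1 : g 1 = z + w := by
    rw [hzw2]; simp only [g, qHermite, hXdef]; push_cast; ring
  have hgr (n : ℕ) : g (n + 2) = (z + w) * g (n + 1) - (1 - (q : ℂ) ^ (n + 1)) * g n := by
    rw [hzw2]
    have h2 := qNat_mul_one_sub q (n + 1)
    have h3 := sq_sqrt_one_sub hq
    have h4 : qHermite q (n + 2) x =
      x * qHermite q (n + 1) x - qNat q (n + 1) * qHermite q n x := rfl
    have : √(1 - q) ^ (n + 2) * qHermite q (n + 2) x =
        2 * X * (√(1 - q) ^ (n + 1) * qHermite q (n + 1) x) -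
          (1 - q ^ (n + 1)) * (√(1 - q) ^ n * qHermite q n x) := by
      rw [h4, ← h2, hXdef]
      linear_combination -√(1 - q) ^ n * qNat q (n + 1) * qHermite q n x * h3
    simp only [g]
    rw [this]
    push_cast
    ring
  have key : ∀ n, ‖g n‖ ≤ (n + 1) * E n ∧ ‖g (n + 1) - z * g n‖ ≤ E n := by
    intro n
    induction n with
    | zero =>
      constructor
      · simp [hg0, E]
      · simp [hg0, hg1, hw, E]
    | succ n ih =>
      obtain ⟨ih1, ih2⟩ := ih
      have h1 : E n ≤ E (n + 1) := le_trans (le_mul_of_one_le_right (hEpos n).le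
        (le_add_of_nonneg_right (by positivity))) (hE n)
      constructor
      · calc ‖g (n + 1)‖ = ‖(g (n + 1) - z * g n) + z * g n‖ := by ring_nf
          _ ≤ E n + 1 * ((n + 1) * E n) := by
            refine (norm_add_le _ _).trans (add_le_add ih2 ?_)
            rw [norm_mul, hz]
            gcongr
          _ = (n + 2) * E n := by ring
          _ ≤ ((n + 1 : ℕ) + 1) * E (n + 1) := by
            push_cast
            rw [show (n : ℝ) + 1 + 1 = n + 2 by ring]
            gcongr
      · have e : g (n + 2) - z * g (n + 1) =
            w * (g (n + 1) - z * g n) + (q : ℂ) ^ (n + 1) * g n := by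
          rw [hgr]
          linear_combination g n * hzw
        have hq1 : |q| ^ (n + 1) ≤ |q| ^ n := pow_le_pow_of_le_one (abs_nonneg q) hq.le (by omega)
        calc ‖g (n + 2) - z * g (n + 1)‖ ≤ 1 * E n + |q| ^ n * ((n + 1) * E n) := by
              rw [e]
              refine (norm_add_le _ _).trans (add_le_add ?_ ?_)
              · rw [norm_mul, hw]
                gcongr
              · rw [norm_mul, norm_pow, Complex.norm_real, Real.norm_eq_abs]
                gcongr
          _ = E n * (1 + (n + 1) * |q| ^ n) := by ring
          _ ≤ _ := hE n
  have h1 := (key n).1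
  simp only [g, Complex.norm_real, Real.norm_eq_abs, abs_mul] at h1
  rw [abs_of_nonneg (by positivity)] at h1
  refine h1.trans ?_
  rw [mul_comm]
  gcongr
  exact Real.exp_le_exp.2 (hsum.sum_le_tsum _ (fun _ _ => by positivity))

theorem qNat_succ_pos {q : ℝ} (hq : |q| < 1) (n : ℕ) : 0 < qNat q (n + 1) := by
  have h1 : |q ^ (n + 1)| < 1 := by
    rw [abs_pow]; exact pow_lt_one₀ (abs_nonneg q) hq (by omega)
  have h2 := qNat_mul_one_sub q (n + 1)
  have h3 : 0 < 1 - q := by linarith [(abs_lt.1 hq).2]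
  have h4 : 0 < 1 - q ^ (n + 1) := by linarith [(abs_lt.1 h1).2]
  rw [← h2] at h4
  exact pos_of_mul_pos_left h4 h3.le

theorem qFact_pos {q : ℝ} (hq : |q| < 1) (n : ℕ) : 0 < qFact q n := by
  induction n with
  | zero => exact one_pos
  | succ n ih => exact mul_pos ih (qNat_succ_pos hq n)

/-- A summable majorant, uniform on `S(q) × S(q)`, of the terms of the series `gammaPM`. -/
theorem exists_summable_bound_gammaPM {q : ℝ} (hq : |q| < 1) {ρ : ℝ} (hρ : |ρ| < 1) (i j : ℕ) :
    ∃ b : ℕ → ℝ, Summable b ∧ ∀ t : ℝ, |t| ≤ |ρ| → ∀ n, ∀ x ∈ Sq q, ∀ y ∈ Sq q,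
      |t ^ n / qFact q n * qHermite q (n + i) x * qHermite q (n + j) y| ≤ b n := by
  have hs := sqrt_one_sub_pos hq
  obtain ⟨C, hC0, hC⟩ := exists_abs_qHermite_le hq
  obtain ⟨r, hr1, hr2⟩ := exists_between hρ
  have hr0 : 0 < r := (abs_nonneg ρ).trans_lt hr1
  set s := √(1 - q) with hsdef
  set b : ℕ → ℝ := fun n => r ^ n / (qFact q n * s ^ (2 * n)) *
    ((n + i + 1) * (n + j + 1)) with hb
  have hF := qFact_pos hq
  have hbpos (n : ℕ) : 0 < b n := by
    have := hF n
    positivity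
  refine ⟨fun n => b n * (C ^ 2 / s ^ (i + j)), Summable.mul_right _ ?_, ?_⟩
  · refine summable_of_ratio_test_tendsto_lt_one hr2
      (Eventually.of_forall fun n => (hbpos n).ne') ?_
    have h1 : Tendsto (fun n : ℕ => 1 - q ^ (n + 1)) atTop (𝓝 (1 - 0)) :=
      ((tendsto_add_atTop_iff_nat 1).2 (tendsto_pow_atTop_nhds_zero_of_abs_lt_one hq)).const_sub 1
    have h2 (i : ℕ) : Tendsto (fun n : ℕ => 1 + 1 / ((n + i : ℕ) + 1 : ℝ)) atTop (𝓝 (1 + 0)) :=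
      ((tendsto_add_atTop_iff_nat i).2 tendsto_one_div_add_atTop_nhds_zero_nat).const_add 1
    have h3 := (((tendsto_const_nhds (x := r)).div h1 (by norm_num)).mul (h2 i)).mul (h2 j)
    simp only [sub_zero, add_zero, mul_one, div_one, Pi.div_apply] at h3
    refine h3.congr fun n => ?_
    rw [Real.norm_of_nonneg (hbpos _).le, Real.norm_of_nonneg (hbpos _).le]
    have h4 := qNat_mul_one_sub q (n + 1)
    have h5 := sq_sqrt_one_sub hq
    rw [← hsdef] at h5
    have h6 := hF n
    have h7 := qNat_succ_pos hq n
    rw [← h4, ← h5]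
    simp only [hb, qFact]
    push_cast
    field_simp
    ring
  · intro t ht n x hx y hy
    have hx' : |qHermite q (n + i) x| ≤ C * (n + i + 1) / s ^ (n + i) := by
      rw [le_div_iff₀ (by positivity), mul_comm]
      exact_mod_cast hC (n + i) x hx
    have hy' : |qHermite q (n + j) y| ≤ C * (n + j + 1) / s ^ (n + j) := by
      rw [le_div_iff₀ (by positivity), mul_comm]
      exact_mod_cast hC (n + j) y hy
    have h6 := hF n
    rw [abs_mul, abs_mul, abs_div, abs_pow, abs_of_pos h6]
    calc _ ≤ r ^ n / qFact q n * (C * (n + i + 1) / s ^ (n + i)) *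
          (C * (n + j + 1) / s ^ (n + j)) := by
          gcongr
          exact ht.trans hr1.le
      _ = _ := by
          simp only [hb]
          field_simp
          ring

theorem summable_gammaPM {q : ℝ} (hq : |q| < 1) {ρ : ℝ} (hρ : |ρ| < 1) (i j : ℕ) {x y : ℝ}
    (hx : x ∈ Sq q) (hy : y ∈ Sq q) :
    Summable fun n => ρ ^ n / qFact q n * qHermite q (n + i) x * qHermite q (n + j) y := by
  obtain ⟨b, hb, h⟩ := exists_summable_bound_gammaPM hq hρ i j
  exact Summable.of_norm_bounded hb fun n => h ρ le_rfl n x hx y hy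

end Growth

section Carlitz

theorem qNat_add (q : ℝ) (m n : ℕ) : qNat q (m + n) = qNat q m + q ^ m * qNat q n := by
  simp only [qNat, Finset.sum_range_add, pow_add, Finset.mul_sum]

theorem qNat_zero (q : ℝ) : qNat q 0 = 0 := by simp [qNat]

theorem mul_qHermite (q : ℝ) (n : ℕ) (x : ℝ) :
    x * qHermite q n x = qHermite q (n + 1) x + qNat q n * qHermite q (n - 1) x := by
  rcases n with _ | n
  · simp [qHermite, qNat]
  · simp [qHermite]

theorem gammaPM_comm (q ρ : ℝ) (i j : ℕ) (x y : ℝ) :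
    gammaPM q ρ i j x y = gammaPM q ρ j i y x := by
  simp only [gammaPM, mul_right_comm _ (qHermite q (_ + i) x)]

theorem hasSum_gammaPM {q : ℝ} (hq : |q| < 1) {ρ : ℝ} (hρ : |ρ| < 1) (i j : ℕ) {x y : ℝ}
    (hx : x ∈ Sq q) (hy : y ∈ Sq q) :
    HasSum (fun n => ρ ^ n / qFact q n * qHermite q (n + i) x * qHermite q (n + j) y)
      (gammaPM q ρ i j x y) :=
  (summable_gammaPM hq hρ i j hx hy).hasSum

theorem hasSum_qNat_mul_gammaPM {q : ℝ} (hq : |q| < 1) {ρ : ℝ} (hρ : |ρ| < 1) (i j : ℕ) {x y : ℝ}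
    (hx : x ∈ Sq q) (hy : y ∈ Sq q) :
    HasSum (fun n => qNat q n * (ρ ^ n / qFact q n * qHermite q (n + i - 1) x *
      qHermite q (n + j) y)) (ρ * gammaPM q ρ i (j + 1) x y) := by
  rw [← hasSum_nat_add_iff' 1]
  simp only [Finset.range_one, Finset.sum_singleton, qNat_zero, zero_mul, sub_zero]
  refine ((hasSum_gammaPM hq hρ i (j + 1) hx hy).mul_left ρ).congr_fun fun n => ?_
  have h1 := qNat_succ_pos hq n
  have h2 := qFact_pos hq n
  rw [show n + 1 + i - 1 = n + i by omega, show n + 1 + j = n + (j + 1) by omega, qFact]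
  field_simp
  ring

theorem mul_gammaPM_left {q : ℝ} (hq : |q| < 1) {ρ : ℝ} (hρ : |ρ| < 1) (i j : ℕ) {x y : ℝ}
    (hx : x ∈ Sq q) (hy : y ∈ Sq q) :
    x * gammaPM q ρ i j x y = gammaPM q ρ (i + 1) j x y +
      qNat q i * gammaPM q ρ (i - 1) j x y + q ^ i * (ρ * gammaPM q ρ i (j + 1) x y) := by
  refine ((hasSum_gammaPM hq hρ i j hx hy).mul_left x).unique
    (((((hasSum_gammaPM hq hρ (i + 1) j hx hy)).add
    ((hasSum_gammaPM hq hρ (i - 1) j hx hy).mul_left (qNat q i))).add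
    ((hasSum_qNat_mul_gammaPM hq hρ i j hx hy).mul_left (q ^ i))).congr_fun fun n => ?_)
  have h1 := mul_qHermite q (n + i) x
  have h2 : qNat q i * qHermite q (n + (i - 1)) x = qNat q i * qHermite q (n + i - 1) x := by
    rcases i with _ | i
    · simp [qNat_zero]
    · rfl
  rw [add_comm n i, qNat_add, add_comm i n] at h1
  rw [← add_assoc]
  linear_combination ρ ^ n / qFact q n * qHermite q (n + j) y * (h1 - h2)

theorem mul_gammaPM_right {q : ℝ} (hq : |q| < 1) {ρ : ℝ} (hρ : |ρ| < 1) (i j : ℕ) {x y : ℝ}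
    (hx : x ∈ Sq q) (hy : y ∈ Sq q) :
    y * gammaPM q ρ i j x y = gammaPM q ρ i (j + 1) x y +
      qNat q j * gammaPM q ρ i (j - 1) x y + q ^ j * (ρ * gammaPM q ρ (i + 1) j x y) := by
  simpa only [gammaPM_comm q ρ _ _ y x] using mul_gammaPM_left hq hρ j i hy hx

theorem one_sub_sq_mul_pow_pos {q ρ : ℝ} (hq : |q| < 1) (hρ : |ρ| < 1) (n : ℕ) :
    0 < 1 - ρ ^ 2 * q ^ n := by
  have h1 : |ρ ^ 2 * q ^ n| < 1 := by
    rw [abs_mul, abs_pow, abs_pow]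
    exact mul_lt_one_of_nonneg_of_lt_one_left (by positivity)
      (pow_lt_one₀ (abs_nonneg _) hρ two_ne_zero) (pow_le_one₀ (abs_nonneg q) hq.le)
  linarith [(abs_lt.1 h1).2]

theorem qPoch_sq_pos {q ρ : ℝ} (hq : |q| < 1) (hρ : |ρ| < 1) (n : ℕ) :
    0 < qPoch (ρ ^ 2) q n :=
  Finset.prod_pos fun j _ => one_sub_sq_mul_pow_pos hq hρ j

theorem qPoch_succ (a q : ℝ) (n : ℕ) : qPoch a q (n + 1) = qPoch a q n * (1 - a * q ^ n) :=
  Finset.prod_range_succ _ _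

theorem gammaPM_left_succ {q : ℝ} (hq : |q| < 1) {ρ : ℝ} (hρ : |ρ| < 1) (i : ℕ) {x y : ℝ}
    (hx : x ∈ Sq q) (hy : y ∈ Sq q) :
    (1 - ρ ^ 2 * q ^ i) * gammaPM q ρ (i + 1) 0 x y =
      (x - ρ * y * q ^ i) * gammaPM q ρ i 0 x y - qNat q i * gammaPM q ρ (i - 1) 0 x y := by
  have h1 := mul_gammaPM_left hq hρ i 0 hx hy
  have h2 := mul_gammaPM_right hq hρ i 0 hx hy
  simp only [qNat_zero, zero_mul, add_zero, pow_zero, one_mul] at h2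
  linear_combination q ^ i * ρ * h2 - h1

theorem gammaPM_left_zero {q : ℝ} (hq : |q| < 1) {ρ : ℝ} (hρ : |ρ| < 1) (i : ℕ) {x y : ℝ}
    (hx : x ∈ Sq q) (hy : y ∈ Sq q) :
    gammaPM q ρ i 0 x y = ascP q y ρ i x / qPoch (ρ ^ 2) q i * gammaPM q ρ 0 0 x y := by
  induction i using Nat.twoStepInduction with
  | zero => simp [ascP, qPoch]
  | one =>
    have h := gammaPM_left_succ hq hρ 0 hx hy
    have h1 := one_sub_sq_mul_pow_pos hq hρ 0
    simp only [qNat_zero, pow_zero, mul_one, zero_mul, sub_zero, zero_add] at h h1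
    simp only [ascP, qPoch, Finset.prod_range_one, pow_zero, mul_one]
    field_simp
    linarith
  | more n ih ih1 =>
    have h := gammaPM_left_succ hq hρ (n + 1) hx hy
    have h0 := qPoch_sq_pos hq hρ n
    have h1 := one_sub_sq_mul_pow_pos hq hρ n
    have h2 := one_sub_sq_mul_pow_pos hq hρ (n + 1)
    rw [add_tsub_cancel_right, ih, ih1, qPoch_succ] at h
    rw [← mul_right_inj' h2.ne', h, qPoch_succ, qPoch_succ, ascP]
    field_simp

theorem qBinom_zero_right {q : ℝ} (hq : |q| < 1) (n : ℕ) : qBinom q n 0 = 1 := by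
  have := qFact_pos hq n
  simp [qBinom, qFact, this.ne']

theorem qBinom_self {q : ℝ} (hq : |q| < 1) (n : ℕ) : qBinom q n n = 1 := by
  have := qFact_pos hq n
  simp [qBinom, qFact, this.ne']

theorem qBinom_eq_zero (q : ℝ) {n k : ℕ} (h : n < k) : qBinom q n k = 0 := by
  simp [qBinom, h]

theorem qBinom_succ_succ {q : ℝ} (hq : |q| < 1) {n k : ℕ} (h : k ≤ n) :
    qBinom q (n + 1) (k + 1) = qBinom q n (k + 1) + q ^ (n - k) * qBinom q n k := by
  obtain ⟨l, rfl⟩ := Nat.exists_eq_add_of_le h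
  rcases l with _ | l
  · simp [qBinom_self hq, qBinom_eq_zero]
  · rw [qBinom, qBinom, qBinom, if_pos (by omega), if_pos (by omega), if_pos (by omega),
      show k + (l + 1) + 1 - (k + 1) = l + 1 by omega, show k + (l + 1) - (k + 1) = l by omega,
      show k + (l + 1) - k = l + 1 by omega]
    have h1 := qFact_pos hq k
    have h2 := qFact_pos hq l
    have h3 := qNat_succ_pos hq k
    have h4 := qNat_succ_pos hq l
    have h5 := qNat_add q (l + 1) (k + 1)
    rw [show l + 1 + (k + 1) = k + (l + 1) + 1 by ring] at h5
    simp only [qFact, ← add_assoc] at h5 ⊢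
    rw [h5]
    field_simp

theorem qNat_sub_mul_qBinom {q : ℝ} (hq : |q| < 1) (n k : ℕ) :
    qNat q (n - k) * qBinom q n k = qNat q n * qBinom q (n - 1) k := by
  rcases lt_trichotomy n k with h | rfl | h
  · rw [qBinom_eq_zero q h, qBinom_eq_zero q (by omega)]; simp
  · rcases n with _ | n
    · simp [qNat_zero]
    · rw [qBinom_eq_zero q (n := n + 1 - 1) (by omega)]; simp [qNat_zero]
  · obtain ⟨l, rfl⟩ := Nat.exists_eq_add_of_lt h
    rw [qBinom, qBinom, if_pos (by omega), if_pos (by omega),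
      show k + l + 1 - k = l + 1 by omega, show k + l + 1 - 1 = k + l by omega,
      show k + l - k = l by omega]
    have h1 := qFact_pos hq k
    have h2 := qFact_pos hq l
    have h4 := qNat_succ_pos hq l
    simp only [qFact]
    field_simp

theorem Qpoly_succ {q : ℝ} (hq : |q| < 1) (ρ : ℝ) (i j : ℕ) (x y : ℝ) :
    Qpoly q ρ i (j + 1) x y = y * Qpoly q ρ i j x y - qNat q j * Qpoly q ρ i (j - 1) x y -
      q ^ j * (ρ * Qpoly q ρ (i + 1) j x y) := by
  set G : ℕ → ℝ := fun s => ascP q y ρ s x / qPoch (ρ ^ 2) q s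
  set c : ℕ → ℕ → ℝ := fun j s =>
    (-1 : ℝ) ^ s * q ^ (s * (s - 1) / 2) * qBinom q j s * ρ ^ s * qHermite q (j - s) y with hc
  have hQ (i j : ℕ) : Qpoly q ρ i j x y = ∑ s ∈ Finset.range (j + 1), c j s * G (i + s) := by
    simp only [Qpoly, c, G, mul_div_assoc]
  have hc0 {j s : ℕ} (h : j < s) : c j s = 0 := by simp [c, qBinom_eq_zero q h]
  have hQ2 : Qpoly q ρ i j x y = ∑ s ∈ Finset.range (j + 2), c j s * G (i + s) := by
    rw [Finset.sum_range_succ, hc0 (by omega), hQ]; simp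
  have hQ1 : qNat q j * Qpoly q ρ i (j - 1) x y =
      qNat q j * ∑ s ∈ Finset.range (j + 2), c (j - 1) s * G (i + s) := by
    rcases j with _ | j
    · simp [qNat_zero]
    · rw [Finset.sum_range_succ, Finset.sum_range_succ, hc0 (by omega), hc0 (by omega), hQ]
      simp
  have hzero : c (j + 1) 0 = y * c j 0 - qNat q j * c (j - 1) 0 := by
    have := mul_qHermite q j y
    simp only [c, qBinom_zero_right hq]
    simp
    linarith
  have hsucc (s : ℕ) (hs : s ≤ j) : c (j + 1) (s + 1) =
      y * c j (s + 1) - qNat q j * c (j - 1) (s + 1) - q ^ j * (ρ * c j s) := by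
    have h1 := qBinom_succ_succ hq hs
    have h2 := qNat_sub_mul_qBinom hq j (s + 1)
    have h3 : q ^ s * q ^ (j - s) = q ^ j := by rw [← pow_add]; congr 1; omega
    have h4 : qBinom q j (s + 1) * (y * qHermite q (j - (s + 1)) y) = qBinom q j (s + 1) *
        (qHermite q (j - s) y + qNat q (j - (s + 1)) * qHermite q (j - 1 - (s + 1)) y) := by
      rcases hs.eq_or_lt with rfl | hs
      · rw [qBinom_eq_zero q (by omega)]; simp
      · rw [mul_qHermite, show j - (s + 1) + 1 = j - s by omega,
          show j - (s + 1) - 1 = j - 1 - (s + 1) by omega]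
    simp only [c, Nat.triangle_succ, pow_add, pow_one, Nat.add_sub_add_right]
    rw [h1, ← h3]
    linear_combination (-1 : ℝ) ^ s * q ^ (s * (s - 1) / 2) * ρ ^ s * ρ * q ^ s *
      (h4 + qHermite q (j - 1 - (s + 1)) y * h2)
  rw [hQ1, hQ2, hQ i (j + 1), hQ (i + 1) j, Finset.sum_range_succ',
    Finset.sum_range_succ' _ (j + 1), Finset.sum_range_succ' _ (j + 1), hzero]
  have hsum : ∑ s ∈ Finset.range (j + 1), c (j + 1) (s + 1) * G (i + (s + 1)) =
      y * ∑ s ∈ Finset.range (j + 1), c j (s + 1) * G (i + (s + 1)) -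
      qNat q j * ∑ s ∈ Finset.range (j + 1), c (j - 1) (s + 1) * G (i + (s + 1)) -
      q ^ j * (ρ * ∑ s ∈ Finset.range (j + 1), c j s * G (i + 1 + s)) := by
    simp only [Finset.mul_sum, ← Finset.sum_sub_distrib]
    refine Finset.sum_congr rfl fun s hs => ?_
    rw [hsucc s (by simpa [Nat.lt_succ_iff] using hs), show i + 1 + s = i + (s + 1) by ring]
    ring
  rw [hsum]
  ring

theorem gammaPM_eq_Qpoly_mul {q : ℝ} (hq : |q| < 1) {ρ : ℝ} (hρ : |ρ| < 1) (i j : ℕ) {x y : ℝ}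
    (hx : x ∈ Sq q) (hy : y ∈ Sq q) :
    gammaPM q ρ i j x y = Qpoly q ρ i j x y * gammaPM q ρ 0 0 x y := by
  have hstep (i j : ℕ) : gammaPM q ρ i (j + 1) x y = y * gammaPM q ρ i j x y -
      qNat q j * gammaPM q ρ i (j - 1) x y - q ^ j * (ρ * gammaPM q ρ (i + 1) j x y) := by
    linarith [mul_gammaPM_right hq hρ i j hx hy]
  have hzero (i : ℕ) : gammaPM q ρ i 0 x y = Qpoly q ρ i 0 x y * gammaPM q ρ 0 0 x y := by
    rw [gammaPM_left_zero hq hρ i hx hy]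
    simp [Qpoly, qBinom_zero_right hq, qHermite]
  induction j using Nat.twoStepInduction generalizing i with
  | zero => exact hzero i
  | one =>
    have h1 := hstep i 0
    have h2 := Qpoly_succ hq ρ i 0 x y
    rw [zero_add] at h1 h2
    rw [h1, h2, hzero, hzero (i + 1), qNat_zero]
    ring
  | more j ih ih1 =>
    rw [hstep, Qpoly_succ hq, ih1, ih1, add_tsub_cancel_right, ih]
    ring

end Carlitz

section PoissonMehler

theorem gammaPM_mul_q {q : ℝ} (hq : |q| < 1) {t : ℝ} (ht : |t| < 1) {x y : ℝ}
    (hx : x ∈ Sq q) (hy : y ∈ Sq q) :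
    gammaPM q (t * q) 0 0 x y = gammaPM q t 0 0 x y - (1 - q) * (t * gammaPM q t 1 1 x y) := by
  refine HasSum.tsum_eq (((hasSum_gammaPM hq ht 0 0 hx hy).sub
    ((hasSum_qNat_mul_gammaPM hq ht 1 0 hx hy).mul_left (1 - q))).congr_fun fun n => ?_)
  have h := qNat_mul_one_sub q n
  simp only [add_tsub_cancel_right, add_zero, mul_pow]
  linear_combination t ^ n / qFact q n * qHermite q n x * qHermite q n y * h

theorem omegaPM_mul_gammaPM {q : ℝ} (hq : |q| < 1) {t : ℝ} (ht : |t| < 1) {x y : ℝ}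
    (hx : x ∈ Sq q) (hy : y ∈ Sq q) :
    omegaPM (x * √(1 - q) / 2) (y * √(1 - q) / 2) t * gammaPM q t 0 0 x y =
      (1 - t ^ 2) * (1 - t ^ 2 * q) * gammaPM q (t * q) 0 0 x y := by
  have h0 := gammaPM_mul_q hq ht hx hy
  have h1 := mul_gammaPM_right hq ht 1 0 hx hy
  have h2 := gammaPM_left_succ hq ht 0 hx hy
  have h3 := gammaPM_left_succ hq ht 1 hx hy
  have h4 : qNat q 1 = 1 := by simp [qNat]
  have h5 := sq_sqrt_one_sub hq
  simp only [qNat_zero, h4, zero_mul, add_zero, sub_zero, pow_zero, pow_one, one_mul, mul_one,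
    zero_add, Nat.reduceAdd, Nat.reduceSub] at h1 h2 h3
  rw [omegaPM]
  linear_combination (1 - t ^ 2) * (1 - t ^ 2 * q) * (-h0 - (1 - q) * t * h1) +
    (1 - q) * t * ((1 - t ^ 2 * q) * y - t * (x - t * y * q)) * h2 -
    (1 - q) * t ^ 2 * (1 - t ^ 2) * h3 +
    (t ^ 2 * (x ^ 2 + y ^ 2) - t * (1 + t ^ 2) * x * y) * gammaPM q t 0 0 x y * h5

theorem abs_mul_pow_le {q : ℝ} (hq : |q| < 1) (ρ : ℝ) (n : ℕ) : |ρ * q ^ n| ≤ |ρ| := by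
  rw [abs_mul, abs_pow]
  exact mul_le_of_le_one_right (abs_nonneg _) (pow_le_one₀ (abs_nonneg _) hq.le)

theorem prod_omegaPM_mul_gammaPM {q : ℝ} (hq : |q| < 1) {ρ : ℝ} (hρ : |ρ| < 1) {x y : ℝ}
    (hx : x ∈ Sq q) (hy : y ∈ Sq q) (N : ℕ) :
    (∏ k ∈ Finset.range N, omegaPM (x * √(1 - q) / 2) (y * √(1 - q) / 2) (ρ * q ^ k)) *
      gammaPM q ρ 0 0 x y = qPoch (ρ ^ 2) q (2 * N) * gammaPM q (ρ * q ^ N) 0 0 x y := by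
  induction N with
  | zero => simp [qPoch]
  | succ N ih =>
    have h := omegaPM_mul_gammaPM hq ((abs_mul_pow_le hq ρ N).trans_lt hρ) hx hy
    rw [Finset.prod_range_succ, mul_right_comm, ih, mul_add_one, qPoch_succ, qPoch_succ,
      pow_succ q N, ← mul_assoc ρ]
    linear_combination qPoch (ρ ^ 2) q (2 * N) * h

theorem summable_abs_mul_pow {q : ℝ} (hq : |q| < 1) (a : ℝ) : Summable fun n => |a * q ^ n| := by
  simp only [abs_mul, abs_pow]
  exact (summable_geometric_of_lt_one (abs_nonneg q) hq).mul_left _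

theorem tendsto_qPoch {q : ℝ} (hq : |q| < 1) (a : ℝ) :
    Tendsto (qPoch a q) atTop (𝓝 (qPochInf a q)) := by
  have h : Summable fun n => ‖-(a * q ^ n)‖ := by
    simpa only [norm_neg, Real.norm_eq_abs] using summable_abs_mul_pow hq a
  have := (multipliable_one_add_of_summable h).tendsto_prod_tprod_nat
  simp only [← sub_eq_add_neg] at this
  exact this

theorem qPochInf_sq_ne_zero {q ρ : ℝ} (hq : |q| < 1) (hρ : |ρ| < 1) : qPochInf (ρ ^ 2) q ≠ 0 := by
  have h : Summable fun n => ‖-(ρ ^ 2 * q ^ n)‖ := by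
    simpa only [norm_neg, Real.norm_eq_abs] using summable_abs_mul_pow hq (ρ ^ 2)
  have := tprod_one_add_ne_zero_of_summable (f := fun n => -(ρ ^ 2 * q ^ n))
    (fun n => by rw [← sub_eq_add_neg]; exact (one_sub_sq_mul_pow_pos hq hρ n).ne') h
  simp only [← sub_eq_add_neg] at this
  exact this

theorem abs_omegaPM_sub_one_le {x y t : ℝ} (hx : x ∈ Set.Icc (-1 : ℝ) 1)
    (hy : y ∈ Set.Icc (-1 : ℝ) 1) (ht : |t| ≤ 1) : |omegaPM x y t - 1| ≤ 19 * |t| := by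
  have hx' : |x| ≤ 1 := abs_le.2 hx
  have hy' : |y| ≤ 1 := abs_le.2 hy
  have e : omegaPM x y t - 1 =
      t * (-2 * t + t * (t ^ 2) - 4 * (1 + t ^ 2) * (x * y) + 4 * t * (x ^ 2 + y ^ 2)) := by
    rw [omegaPM]; ring
  have hx2 : x ^ 2 ≤ 1 := (sq_le_one_iff_abs_le_one x).2 hx'
  have hy2 : y ^ 2 ≤ 1 := (sq_le_one_iff_abs_le_one y).2 hy'
  have ht2 : t ^ 2 ≤ 1 := (sq_le_one_iff_abs_le_one t).2 ht
  have hxy : |x * y| ≤ 1 := by rw [abs_mul]; exact mul_le_one₀ hx' (abs_nonneg _) hy'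
  rw [e, abs_mul, mul_comm]
  gcongr
  calc _ ≤ |-2 * t| + |t * t ^ 2| + |4 * (1 + t ^ 2) * (x * y)| + |4 * t * (x ^ 2 + y ^ 2)| := by
        refine (abs_add_le _ _).trans (add_le_add ?_ le_rfl)
        refine (abs_sub _ _).trans (add_le_add (abs_add_le _ _) le_rfl)
    _ ≤ 2 * 1 + 1 * 1 + 4 * (1 + 1) * 1 + 4 * 1 * (1 + 1) := by
        simp only [abs_mul, abs_neg, Nat.abs_ofNat]
        rw [abs_of_nonneg (by positivity : 0 ≤ 1 + t ^ 2),
          abs_of_nonneg (by positivity : 0 ≤ x ^ 2 + y ^ 2), abs_of_nonneg (sq_nonneg t),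
          ← abs_mul]
        gcongr
    _ = 19 := by norm_num

theorem tendsto_prod_omegaPM {q : ℝ} (hq : |q| < 1) {ρ : ℝ} (hρ : |ρ| < 1) {x y : ℝ}
    (hx : x ∈ Set.Icc (-1 : ℝ) 1) (hy : y ∈ Set.Icc (-1 : ℝ) 1) :
    Tendsto (fun N => ∏ k ∈ Finset.range N, omegaPM x y (ρ * q ^ k)) atTop
      (𝓝 (∏' k : ℕ, omegaPM x y (ρ * q ^ k))) := by
  have h : Summable fun n => ‖omegaPM x y (ρ * q ^ n) - 1‖ :=
    Summable.of_nonneg_of_le (fun _ => norm_nonneg _)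
      (fun n => abs_omegaPM_sub_one_le hx hy ((abs_mul_pow_le hq ρ n).trans hρ.le))
      ((summable_abs_mul_pow hq ρ).mul_left 19)
  have := (multipliable_one_add_of_summable h).tendsto_prod_tprod_nat
  simpa only [add_sub_cancel] using this

theorem tendsto_gammaPM_mul_pow {q : ℝ} (hq : |q| < 1) {ρ : ℝ} (hρ : |ρ| < 1) {x y : ℝ}
    (hx : x ∈ Sq q) (hy : y ∈ Sq q) :
    Tendsto (fun N => gammaPM q (ρ * q ^ N) 0 0 x y) atTop (𝓝 1) := by
  obtain ⟨b, hb, h⟩ := exists_summable_bound_gammaPM hq hρ 0 0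
  have h0 : Tendsto (fun N : ℕ => ρ * q ^ N) atTop (𝓝 0) := by
    simpa using (tendsto_pow_atTop_nhds_zero_of_abs_lt_one hq).const_mul ρ
  have key := tendsto_tsum_of_dominated_convergence (𝓕 := atTop)
    (f := fun N n => (ρ * q ^ N) ^ n / qFact q n * qHermite q (n + 0) x * qHermite q (n + 0) y)
    (g := fun n => 0 ^ n / qFact q n * qHermite q (n + 0) x * qHermite q (n + 0) y) hb
    (fun n => (((h0.pow n).div_const _).mul_const _).mul_const _)
    (Eventually.of_forall fun N n => h _ (abs_mul_pow_le hq ρ N) n x hx y hy)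
  rw [tsum_eq_single 0 (fun n hn => by simp [hn])] at key
  simpa [gammaPM, qFact, qHermite] using key

theorem f2D_eq_gammaPM_mul {q : ℝ} (hq : |q| < 1) {ρ : ℝ} (hρ : |ρ| < 1) {x y : ℝ}
    (hx : x ∈ Sq q) (hy : y ∈ Sq q) :
    f2D q ρ x y = gammaPM q ρ 0 0 x y * fN q x * fN q y := by
  have h1 := (tendsto_prod_omegaPM hq hρ ((mem_Sq_iff hq x).1 hx)
    ((mem_Sq_iff hq y).1 hy)).mul_const (gammaPM q ρ 0 0 x y)
  have h2 := ((tendsto_qPoch hq (ρ ^ 2)).comp (tendsto_id.const_mul_atTop' two_pos)).mul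
    (tendsto_gammaPM_mul_pow hq hρ hx hy)
  have h3 := tendsto_nhds_unique (h1.congr (prod_omegaPM_mul_gammaPM hq hρ hx hy)) h2
  have h4 := qPochInf_sq_ne_zero hq hρ
  rw [mul_one] at h3
  rw [← h3] at h4
  rw [f2D, fCN, ← h3]
  have h5 := left_ne_zero_of_mul h4
  generalize ∏' k : ℕ, omegaPM _ _ (ρ * q ^ k) = w at *
  field_simp

theorem Qpoly_mul_f2D {q : ℝ} (hq : |q| < 1) {ρ : ℝ} (hρ : |ρ| < 1) (i j : ℕ) {x y : ℝ}
    (hx : x ∈ Sq q) (hy : y ∈ Sq q) :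
    Qpoly q ρ i j x y * f2D q ρ x y = gammaPM q ρ i j x y * fN q x * fN q y := by
  rw [f2D_eq_gammaPM_mul hq hρ hx hy, gammaPM_eq_Qpoly_mul hq hρ i j hx hy]
  ring

end PoissonMehler

section BivariatePolynomial

/-- `f` is a polynomial in two real variables of total degree at most `d`. -/
def IsBivariatePolynomial (d : ℕ) (f : ℝ → ℝ → ℝ) : Prop :=
  ∃ p : MvPolynomial (Fin 2) ℝ, p.totalDegree ≤ d ∧ ∀ x y, MvPolynomial.eval ![x, y] p = f x y

namespace IsBivariatePolynomial

variable {d e : ℕ} {f g : ℝ → ℝ → ℝ}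

theorem const (c : ℝ) : IsBivariatePolynomial d fun _ _ => c :=
  ⟨MvPolynomial.C c, by simp, by simp⟩

theorem fst : IsBivariatePolynomial 1 fun x _ => x :=
  ⟨MvPolynomial.X 0, by simp, by simp⟩

theorem snd : IsBivariatePolynomial 1 fun _ y => y :=
  ⟨MvPolynomial.X 1, by simp, by simp⟩

theorem mono (hf : IsBivariatePolynomial d f) (h : d ≤ e) : IsBivariatePolynomial e f := by
  obtain ⟨p, hp, hpf⟩ := hf
  exact ⟨p, hp.trans h, hpf⟩

theorem mul (hf : IsBivariatePolynomial d f) (hg : IsBivariatePolynomial e g) :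
    IsBivariatePolynomial (d + e) fun x y => f x y * g x y := by
  obtain ⟨p, hp, hpf⟩ := hf
  obtain ⟨r, hr, hrg⟩ := hg
  exact ⟨p * r, (MvPolynomial.totalDegree_mul _ _).trans (add_le_add hp hr), by simp [hpf, hrg]⟩

theorem const_mul (c : ℝ) (hf : IsBivariatePolynomial d f) :
    IsBivariatePolynomial d fun x y => c * f x y := by
  simpa using (const (d := 0) c).mul hf

theorem sub (hf : IsBivariatePolynomial d f) (hg : IsBivariatePolynomial d g) :
    IsBivariatePolynomial d fun x y => f x y - g x y := by
  obtain ⟨p, hp, hpf⟩ := hf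
  obtain ⟨r, hr, hrg⟩ := hg
  exact ⟨p - r, (MvPolynomial.totalDegree_sub _ _).trans (max_le hp hr), by simp [hpf, hrg]⟩

theorem sum {ι : Type*} {s : Finset ι} {F : ι → ℝ → ℝ → ℝ}
    (h : ∀ k ∈ s, IsBivariatePolynomial d (F k)) :
    IsBivariatePolynomial d fun x y => ∑ k ∈ s, F k x y := by
  choose! p hp hpf using h
  refine ⟨∑ k ∈ s, p k, MvPolynomial.totalDegree_finsetSum_le hp, fun x y => ?_⟩
  rw [map_sum]
  exact Finset.sum_congr rfl fun k hk => hpf k hk x y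

theorem qHermite (q : ℝ) (n : ℕ) : IsBivariatePolynomial n fun _ y => qHermite q n y := by
  induction n using Nat.twoStepInduction with
  | zero => exact const 1
  | one => exact snd
  | more n h0 h1 =>
    exact ((snd.mul h1).mono (by omega)).sub ((h0.const_mul (qNat q (n + 1))).mono (by omega))

theorem ascP (q ρ : ℝ) (n : ℕ) : IsBivariatePolynomial n fun x y => ascP q y ρ n x := by
  induction n using Nat.twoStepInduction with
  | zero => exact const 1
  | one => exact fst.sub (snd.const_mul ρ)
  | more n h0 h1 =>
    have h := (((fst.sub (snd.const_mul (ρ * q ^ (n + 1)))).mul h1).mono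
      (show _ ≤ n + 2 by omega)).sub
      ((h0.const_mul (qNat q (n + 1) * (1 - ρ ^ 2 * q ^ n))).mono (by omega))
    simpa only [_root_.ascP, mul_right_comm ρ] using h

end IsBivariatePolynomial

theorem isBivariatePolynomial_Qpoly (q ρ : ℝ) (i j : ℕ) :
    IsBivariatePolynomial (i + j) (Qpoly q ρ i j) := by
  refine IsBivariatePolynomial.sum fun s hs => ?_
  have hs' := Finset.mem_range_succ_iff.1 hs
  have h := (((IsBivariatePolynomial.qHermite q (j - s)).mul
    (IsBivariatePolynomial.ascP q ρ (i + s))).const_mul ((-1) ^ s * q ^ (s * (s - 1) / 2) *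
      qBinom q j s * ρ ^ s / qPoch (ρ ^ 2) q (i + s))).mono (show _ ≤ i + j by omega)
  convert h using 3
  ring

end BivariatePolynomial

section Bivariate

theorem continuousOn_gammaPM_right {q : ℝ} (hq : |q| < 1) {ρ : ℝ} (hρ : |ρ| < 1) (i j : ℕ) {x : ℝ}
    (hx : x ∈ Sq q) : ContinuousOn (gammaPM q ρ i j x) (Sq q) := by
  obtain ⟨b, hb, h⟩ := exists_summable_bound_gammaPM hq hρ i j
  exact continuousOn_tsum (fun n => by fun_prop) hb fun n y hy => h ρ le_rfl n x hx y hy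

theorem integral_pow_mul_gammaPM_mul_fN {q : ℝ} (hq : |q| < 1) {ρ : ℝ} (hρ : |ρ| < 1) (i j b : ℕ)
    {x : ℝ} (hx : x ∈ Sq q) :
    ∫ y in Sq q, y ^ b * gammaPM q ρ i j x y * fN q y =
      ∑ n ∈ Finset.range (b + 1), ρ ^ n / qFact q n *
        (∫ y in Sq q, y ^ b * qHermite q (n + j) y * fN q y) * qHermite q (n + i) x := by
  obtain ⟨B, hB, h⟩ := exists_summable_bound_gammaPM hq hρ i j
  have hi : IntegrableOn (fun y => y ^ b * fN q y) (Sq q) := integrableOn_mul_fN hq (by fun_prop)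
  have key := hasSum_integral_of_dominated_convergence (μ := volume.restrict (Sq q))
    (F := fun n y => y ^ b * fN q y *
      (ρ ^ n / qFact q n * qHermite q (n + i) x * qHermite q (n + j) y))
    (f := fun y => y ^ b * fN q y * gammaPM q ρ i j x y)
    (fun n y => |y ^ b * fN q y| * B n)
    (fun n => hi.aestronglyMeasurable.mul (by fun_prop))
    (fun n => by
      filter_upwards [ae_restrict_mem (measurableSet_Sq q)] with y hy
      rw [Real.norm_eq_abs, abs_mul]
      gcongr
      exact h ρ le_rfl n x hx y hy)
    (Eventually.of_forall fun y => hB.mul_left _)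
    (by simpa only [tsum_mul_left, Real.norm_eq_abs] using hi.norm.mul_const _)
    (by
      filter_upwards [ae_restrict_mem (measurableSet_Sq q)] with y hy
      exact (hasSum_gammaPM hq hρ i j hx hy).mul_left _)
  have e (n : ℕ) : ∫ y in Sq q, y ^ b * fN q y *
      (ρ ^ n / qFact q n * qHermite q (n + i) x * qHermite q (n + j) y) = ρ ^ n / qFact q n *
        (∫ y in Sq q, y ^ b * qHermite q (n + j) y * fN q y) * qHermite q (n + i) x := by
    rw [mul_right_comm, ← integral_const_mul]
    congr 1
    ext y
    ring
  simp only [e] at key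
  simp only [mul_right_comm _ (fN q _)] at key
  refine key.unique (hasSum_sum_of_ne_finset_zero fun n hn => ?_)
  rw [integral_pow_mul_qHermite_mul_fN hq (by simp at hn; omega)]
  simp

theorem integral_integral_mul_gammaPM_eq_zero {q : ℝ} (hq : |q| < 1) {ρ : ℝ} (hρ : |ρ| < 1)
    {i j d : ℕ} {f : ℝ → ℝ → ℝ} (hf : IsBivariatePolynomial d f) (hd : d < i + j) :
    ∫ x in Sq q, ∫ y in Sq q, f x y * (gammaPM q ρ i j x y * fN q x * fN q y) = 0 := by
  obtain ⟨p, hp, hpf⟩ := hf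
  set K : ℕ → ℕ → ℝ := fun b n =>
    ρ ^ n / qFact q n * ∫ y in Sq q, y ^ b * qHermite q (n + j) y * fN q y with hK
  have hinner {x : ℝ} (hx : x ∈ Sq q) :
      ∫ y in Sq q, f x y * (gammaPM q ρ i j x y * fN q x * fN q y) =
        ∑ m ∈ p.support, ∑ n ∈ Finset.range (m 1 + 1), p.coeff m * K (m 1) n *
          (x ^ m 0 * qHermite q (n + i) x * fN q x) := by
    have e (y : ℝ) : f x y * (gammaPM q ρ i j x y * fN q x * fN q y) =
        ∑ m ∈ p.support, p.coeff m * x ^ m 0 * fN q x *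
          (y ^ m 1 * gammaPM q ρ i j x y * fN q y) := by
      rw [← hpf, MvPolynomial.eval_eq', Finset.sum_mul]
      refine Finset.sum_congr rfl fun m _ => ?_
      simp only [Fin.prod_univ_two, Matrix.cons_val_zero, Matrix.cons_val_one]
      ring
    have h_int (b : ℕ) : IntegrableOn (fun y => y ^ b * gammaPM q ρ i j x y * fN q y) (Sq q) :=
      integrableOn_mul_fN_of_continuousOn hq
        ((continuous_pow b).continuousOn.mul (continuousOn_gammaPM_right hq hρ i j hx))
    simp only [e]
    rw [integral_finsetSum _ fun m _ => (h_int (m 1)).const_mul _]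
    refine Finset.sum_congr rfl fun m _ => ?_
    rw [integral_const_mul, integral_pow_mul_gammaPM_mul_fN hq hρ i j _ hx, Finset.mul_sum]
    refine Finset.sum_congr rfl fun n _ => ?_
    simp only [hK]
    ring
  have h_int (c : ℝ) (a n : ℕ) :
      IntegrableOn (fun x => c * (x ^ a * qHermite q n x * fN q x)) (Sq q) :=
    (integrableOn_mul_fN hq (by fun_prop)).const_mul _
  rw [setIntegral_congr_fun (measurableSet_Sq q) fun x hx => hinner hx,
    integral_finsetSum _ fun m _ => integrable_finsetSum _ fun n _ => h_int _ _ _]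
  refine Finset.sum_eq_zero fun m hm => ?_
  rw [integral_finsetSum _ fun n _ => h_int _ _ _]
  refine Finset.sum_eq_zero fun n _ => ?_
  have hm' : m 0 + m 1 ≤ d := by
    have := (MvPolynomial.le_totalDegree hm).trans hp
    rwa [Finsupp.sum_fintype _ _ (by simp), Fin.sum_univ_two] at this
  rw [integral_const_mul]
  rcases lt_or_ge (m 1) (n + j) with h | h
  · simp [hK, integral_pow_mul_qHermite_mul_fN hq h]
  · rw [integral_pow_mul_qHermite_mul_fN hq (by omega : m 0 < n + i), mul_zero]

theorem integral_Qpoly_mul_Qpoly_mul_f2D_of_lt {q : ℝ} (hq : |q| < 1) {ρ : ℝ} (hρ : |ρ| < 1)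
    {i j m k : ℕ} (h : m + k < i + j) :
    ∫ x in Sq q, ∫ y in Sq q, Qpoly q ρ i j x y * Qpoly q ρ m k x y * f2D q ρ x y = 0 := by
  rw [← integral_integral_mul_gammaPM_eq_zero hq hρ (isBivariatePolynomial_Qpoly q ρ m k) h]
  refine setIntegral_congr_fun (measurableSet_Sq q) fun x hx => ?_
  refine setIntegral_congr_fun (measurableSet_Sq q) fun y hy => ?_
  simp only [← Qpoly_mul_f2D hq hρ i j hx hy]
  ring

end Bivariate

/-- for i+j ≠ m+k the polynomials Q_{i,j} and Q_{m,k} are orthogonal with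
respect to the (ρ,q)-bivariate Normal density f_{2D} on S(q) × S(q). -/
theorem statement7 (q ρ : ℝ) (hq : |q| < 1) (hρ : |ρ| < 1) (i j m k : ℕ)
    (h : i + j ≠ m + k) :
    (∫ x in Sq q, ∫ y in Sq q,
      Qpoly q ρ i j x y * Qpoly q ρ m k x y * f2D q ρ x y) = 0 := by
  rcases h.lt_or_gt with h | h
  · simpa only [mul_comm (Qpoly q ρ m k _ _)] using
      integral_Qpoly_mul_Qpoly_mul_f2D_of_lt hq hρ h
  · exact integral_Qpoly_mul_Qpoly_mul_f2D_of_lt hq hρ h
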